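/- (NTK linearisation with controlled remainder) Let $d,m\ge 1$ be integers, let $u\in\{\pm 1/\sqrt m\}^m$, and let $\varphi:\mathbb R\to\mathbb R$ be twice differentiable with $|\varphi''(s)|\le B_{\varphi''}$ for all $s\in\mathbb R$. For $W\in\mathbb R^{d\times m}$ with columns $W_1,\dots,W_m\in\mathbb R^d$ let $f_W(x)=\sum_{k=1}^m u_k\,\varphi(\langle W_k,x\rangle)$ be the shallow network of width $m$. Then for any $W,\widetilde W\in\mathbb R^{d\times m}$ and any $x\in\mathbb R^d$, $$f_W(x)=f_{\widetilde W}(x)+\sum_{k=1}^m u_k\,\varphi'(\langle x,\widetilde W_k\rangle)\,\langle W_k-\widetilde W_k,x\rangle+\epsilon(x),$$ where $$\epsilon(x)=\sum_{k=1}^m u_k\left(\int_0^1(1-\tau)\,\varphi''\big(\tau\langle x,W_k\rangle+(1-\tau)\langle x,\widetilde W_k\rangle\big)\,d\tau\right)\langle x,W_k-\widetilde W_k\rangle^2$$ (the integrands being Lebesgue integrable), and the remainder satisfies $$|\epsilon(x)|\le\frac{B_{\varphi''}\,\|x\|_2^2}{2\sqrt m}\,\|W-\widetilde W\|_F^2 .$$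 -/

import Mathlib

open scoped RealInnerProductSpace

-- `‖A‖` for a matrix `A` denotes the Frobenius norm.
attribute [local instance] Matrix.frobeniusNormedAddCommGroup

noncomputable section

/-- The `k`-th column `W_k ∈ ℝ^d` of `W ∈ ℝ^{d×m}`, as a Euclidean vector. -/
def colVec {d m : ℕ} (W : Matrix (Fin d) (Fin m) ℝ) (k : Fin m) : EuclideanSpace ℝ (Fin d) :=
  WithLp.toLp 2 (fun j => W j k)

/-- The shallow network `f_W(x) = ∑ₖ uₖ φ(⟨W_k, x⟩)`. -/
def nnet {d m : ℕ} (φ : ℝ → ℝ) (u : Fin m → ℝ) (W : Matrix (Fin d) (Fin m) ℝ)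
    (x : EuclideanSpace ℝ (Fin d)) : ℝ :=
  ∑ k : Fin m, u k * φ ⟪colVec W k, x⟫

/-- The remainder
`ε(x) = ∑ₖ uₖ (∫₀¹ (1 - τ) φ''(τ⟨x, W_k⟩ + (1 - τ)⟨x, W̃_k⟩) dτ) ⟨x, W_k - W̃_k⟩²`. -/
def ntkRemainder {d m : ℕ} (φ : ℝ → ℝ) (u : Fin m → ℝ) (W Wt : Matrix (Fin d) (Fin m) ℝ)
    (x : EuclideanSpace ℝ (Fin d)) : ℝ :=
  ∑ k : Fin m, u k
    * (∫ τ in (0 : ℝ)..1, (1 - τ) *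
        deriv (deriv φ) (τ * ⟪x, colVec W k⟫ + (1 - τ) * ⟪x, colVec Wt k⟫))
    * ⟪x, colVec W k - colVec Wt k⟫ ^ 2

end

open MeasureTheory in
/-- If `g` is differentiable with bounded derivative, the Taylor remainder integrand built from its
derivative is integrable on `[0, 1]`. -/
theorem intervalIntegrable_one_sub_mul_deriv_segment {g : ℝ → ℝ} {B : ℝ}
    (hB : ∀ s, |deriv g s| ≤ B) (a b : ℝ) :
    IntervalIntegrable (fun τ : ℝ => (1 - τ) * deriv g (τ * a + (1 - τ) * b)) volume 0 1 := by
  have hmeas : Measurable fun τ : ℝ => deriv g (τ * a + (1 - τ) * b) :=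
    (measurable_deriv g).comp (by fun_prop)
  have hint : IntervalIntegrable (fun τ : ℝ => deriv g (τ * a + (1 - τ) * b)) volume 0 1 :=
    (intervalIntegrable_const (c := B)).mono_fun' hmeas.aestronglyMeasurable
      (Filter.Eventually.of_forall fun τ => hB _)
  exact hint.continuousOn_mul (by fun_prop)

/-- Second order Taylor formula with integral remainder for a twice differentiable function whose
second derivative is bounded but not necessarily continuous. -/
theorem taylor_two_integral_remainder {φ : ℝ → ℝ} {B : ℝ}
    (hφ : Differentiable ℝ φ) (hφ' : Differentiable ℝ (deriv φ))
    (hB : ∀ s, |deriv (deriv φ) s| ≤ B) (a b : ℝ) :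
    φ a = φ b + deriv φ b * (a - b)
      + (∫ τ in (0 : ℝ)..1, (1 - τ) * deriv (deriv φ) (τ * a + (1 - τ) * b)) * (a - b) ^ 2 := by
  have hγ : ∀ τ : ℝ, HasDerivAt (fun τ : ℝ => τ * a + (1 - τ) * b) (a - b) τ := fun τ => by
    refine (((hasDerivAt_id' τ).mul_const a).add
      (((hasDerivAt_id' τ).const_sub 1).mul_const b)).congr_deriv ?_
    ring
  have hF : ∀ τ : ℝ, HasDerivAt
      (fun τ : ℝ => (1 - τ) * (deriv φ (τ * a + (1 - τ) * b) * (a - b)) + φ (τ * a + (1 - τ) * b))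
      ((1 - τ) * deriv (deriv φ) (τ * a + (1 - τ) * b) * (a - b) ^ 2) τ := fun τ => by
    have h₁ := (hφ _).hasDerivAt.comp τ (hγ τ)
    have h₂ := (hφ' _).hasDerivAt.comp τ (hγ τ)
    refine ((((hasDerivAt_id' τ).const_sub 1).mul (h₂.mul_const (a - b))).add h₁).congr_deriv ?_
    simp only [Function.comp_apply]
    ring
  have h := intervalIntegral.integral_eq_sub_of_hasDerivAt (a := 0) (b := 1) (fun τ _ => hF τ)
    ((intervalIntegrable_one_sub_mul_deriv_segment hB a b).mul_const _)
  rw [intervalIntegral.integral_mul_const] at h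
  rw [h]
  simp only [sub_self, zero_mul, one_mul, add_zero, zero_add, sub_zero]
  ring

theorem abs_integral_one_sub_mul_le {g : ℝ → ℝ} {B : ℝ} (hB : ∀ s, |g s| ≤ B) :
    |∫ τ in (0 : ℝ)..1, (1 - τ) * g τ| ≤ B / 2 := by
  have hbound : ∀ τ ∈ Set.Ioc (0 : ℝ) 1, ‖(1 - τ) * g τ‖ ≤ (1 - τ) * B := fun τ hτ => by
    rw [Real.norm_eq_abs, abs_mul, abs_of_nonneg (sub_nonneg.2 hτ.2)]
    exact mul_le_mul_of_nonneg_left (hB τ) (sub_nonneg.2 hτ.2)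
  have h := intervalIntegral.norm_integral_le_of_norm_le (μ := MeasureTheory.volume) zero_le_one
    (Filter.Eventually.of_forall hbound)
    (Continuous.intervalIntegrable (by fun_prop) 0 1)
  rw [Real.norm_eq_abs] at h
  refine h.trans_eq ?_
  rw [intervalIntegral.integral_mul_const, intervalIntegral.integral_sub (by simp) (by simp)]
  simp
  ring

theorem sum_norm_sq_colVec_sub {d m : ℕ} (W Wt : Matrix (Fin d) (Fin m) ℝ) :
    ∑ k, ‖colVec W k - colVec Wt k‖ ^ 2 = ‖W - Wt‖ ^ 2 := by
  rw [Matrix.frobenius_norm_def, ← Real.sqrt_eq_rpow, Real.sq_sqrt (by positivity),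
    Finset.sum_comm]
  refine Finset.sum_congr rfl fun k _ => ?_
  rw [EuclideanSpace.norm_sq_eq]
  exact Finset.sum_congr rfl fun j _ => by simp [colVec]

/-- Linearisation of a shallow network around `W̃` with a controlled remainder. -/
theorem statement9 {d m : ℕ} (hm : 0 < m)
    (φ : ℝ → ℝ) (B : ℝ)
    (hφ : Differentiable ℝ φ) (hφ' : Differentiable ℝ (deriv φ))
    (hB : ∀ s : ℝ, |deriv (deriv φ) s| ≤ B)
    (u : Fin m → ℝ) (hu : ∀ k, u k = 1 / √(m : ℝ) ∨ u k = -(1 / √(m : ℝ)))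
    (W Wt : Matrix (Fin d) (Fin m) ℝ) (x : EuclideanSpace ℝ (Fin d)) :
    (∀ k : Fin m, IntervalIntegrable
      (fun τ : ℝ => (1 - τ) *
        deriv (deriv φ) (τ * ⟪x, colVec W k⟫ + (1 - τ) * ⟪x, colVec Wt k⟫))
      MeasureTheory.volume 0 1)
    ∧ nnet φ u W x
        = nnet φ u Wt x
          + ∑ k : Fin m, u k * deriv φ ⟪x, colVec Wt k⟫ * ⟪colVec W k - colVec Wt k, x⟫
          + ntkRemainder φ u W Wt x
    ∧ |ntkRemainder φ u W Wt x| ≤ B * ‖x‖ ^ 2 / (2 * √(m : ℝ)) * ‖W - Wt‖ ^ 2 := by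
  have habs : ∀ k, |u k| = 1 / √(m : ℝ) := fun k => by
    have h0 : (0 : ℝ) ≤ 1 / √(m : ℝ) := by positivity
    rcases hu k with h | h <;> simp only [h, abs_neg, abs_of_nonneg h0]
  refine ⟨fun k => intervalIntegrable_one_sub_mul_deriv_segment hB _ _, ?_, ?_⟩
  · simp only [nnet, ntkRemainder, ← Finset.sum_add_distrib]
    refine Finset.sum_congr rfl fun k _ => ?_
    rw [real_inner_comm x (colVec W k), real_inner_comm x (colVec Wt k),
      real_inner_comm x (colVec W k - colVec Wt k), inner_sub_right,
      taylor_two_integral_remainder hφ hφ' hB ⟪x, colVec W k⟫ ⟪x, colVec Wt k⟫]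
    ring
  · have hB0 : 0 ≤ B := (abs_nonneg _).trans (hB 0)
    rw [← sum_norm_sq_colVec_sub, Finset.mul_sum]
    refine (Finset.abs_sum_le_sum_abs _ _).trans (Finset.sum_le_sum fun k _ => ?_)
    have hinner : ⟪x, colVec W k - colVec Wt k⟫ ^ 2
        ≤ (‖x‖ * ‖colVec W k - colVec Wt k‖) ^ 2 :=
      sq_le_sq.2 ((abs_real_inner_le_norm _ _).trans (le_abs_self _))
    rw [abs_mul, abs_mul, habs, abs_of_nonneg (sq_nonneg ⟪x, colVec W k - colVec Wt k⟫)]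
    calc _ ≤ 1 / √(m : ℝ) * (B / 2) * (‖x‖ * ‖colVec W k - colVec Wt k‖) ^ 2 := by
          gcongr
          exact abs_integral_one_sub_mul_le fun τ => hB _
      _ = _ := by
          field_simp
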